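/- arXiv:2509.17584 — 6 statements merged into one kernel-verified Lean document; each statement's English description precedes it below -/
import Mathlib

section
/- For every three-module one-bit classical sequential processor with output O : {0,1}^6 → {-1,1}, the number of errors of O with respect to the target function T, namely the cardinality of {x ∈ {0,1}^6 : T(x) ≠ 0 and O(x) ≠ T(x)}, is at least 8. -/
/-- Domain of six input bits. -/
abbrev Bits6 := Fin 2 × Fin 2 × Fin 2 × Fin 2 × Fin 2 × Fin 2

/-- The 4×16 matrix defining the target function of the three-module single-qubit
processor. -/
def M : Fin 4 → Fin 16 → ℤ :=
  ![![-1,  1,  0,  0,  1, -1,  0,  0,  0,  0,  1, -1,  0,  0, -1,  1],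
    ![ 1, -1,  0,  0, -1,  1,  0,  0,  0,  0, -1,  1,  0,  0,  1, -1],
    ![ 0,  0,  1, -1,  0,  0, -1,  1,  1, -1,  0,  0, -1,  1,  0,  0],
    ![ 0,  0, -1,  1,  0,  0,  1, -1, -1,  1,  0,  0,  1, -1,  0,  0]]

/-- Row index `2*X1 + X2`. -/
def row4 (x1 x2 : Fin 2) : Fin 4 := ⟨2 * x1.val + x2.val, by omega⟩

/-- Column index `8*X3 + 4*X4 + 2*X5 + X6`. -/
def col16 (x3 x4 x5 x6 : Fin 2) : Fin 16 :=
  ⟨8 * x3.val + 4 * x4.val + 2 * x5.val + x6.val, by omega⟩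

/-- The target function `T : {0,1}^6 → {-1,0,1}`. -/
def T : Bits6 → ℤ
  | (x1, x2, x3, x4, x5, x6) => M (row4 x1 x2) (col16 x3 x4 x5 x6)

/-- Output of a three-module one-bit classical sequential processor given by the
module strategies `f1`, `f2`, `f3`. -/
def output3bit (f1 : Fin 2 × Fin 2 → Fin 2) (f2 : Fin 2 → Fin 2 × Fin 2 → Fin 2)
    (f3 : Fin 2 → Fin 2 × Fin 2 → ℤ) : Bits6 → ℤ
  | (x1, x2, x3, x4, x5, x6) => f3 (f2 (f1 (x1, x2)) (x3, x4)) (x5, x6)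

/-- A function of one bit is affine in the integer value of that bit. -/
lemma apply_fin_two_eq_affine (g : Fin 2 → ℤ) (t : Fin 2) :
    g t = g 0 + (t.val : ℤ) * (g 1 - g 0) := by
  fin_cases t <;> simp

/-- The output is a part independent of `x1, x2` plus a product of three factors. -/
lemma output3bit_eq (f1 : Fin 2 × Fin 2 → Fin 2) (f2 : Fin 2 → Fin 2 × Fin 2 → Fin 2)
    (f3 : Fin 2 → Fin 2 × Fin 2 → ℤ) (x1 x2 x3 x4 x5 x6 : Fin 2) :
    output3bit f1 f2 f3 (x1, x2, x3, x4, x5, x6) =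
      (f3 0 (x5, x6) + ((f2 0 (x3, x4)).val : ℤ) * (f3 1 (x5, x6) - f3 0 (x5, x6))) +
      ((f1 (x1, x2)).val : ℤ) *
        (((f2 1 (x3, x4)).val : ℤ) - ((f2 0 (x3, x4)).val : ℤ)) *
        (f3 1 (x5, x6) - f3 0 (x5, x6)) := by
  have h2 := apply_fin_two_eq_affine (fun s => ((f2 s (x3, x4)).val : ℤ)) (f1 (x1, x2))
  have h3 := apply_fin_two_eq_affine (fun t => f3 t (x5, x6)) (f2 (f1 (x1, x2)) (x3, x4))
  simp only [output3bit]
  rw [h3, h2]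
  ring

/-- A three-party inequality of CHSH type. -/
lemma trilinear_le_sixteen {a b c d p q : ℤ} (ha : |a| ≤ 1) (hb : |b| ≤ 1)
    (hc : |c| ≤ 2) (hd : |d| ≤ 2) (hp : |p| ≤ 4) (hq : |q| ≤ 4) :
    a * (c * p + d * q) + b * (c * q - d * p) ≤ 16 := by
  rw [abs_le] at *
  obtain ⟨ha, ha'⟩ := ha
  obtain ⟨hb, hb'⟩ := hb
  obtain ⟨hc, hc'⟩ := hc
  obtain ⟨hd, hd'⟩ := hd
  interval_cases a <;> interval_cases b <;> interval_cases c <;> interval_cases d <;> omega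

/-- The correlation of a processor's output with the target is at most 16. -/
lemma sum_T_mul_output3bit_le (f1 : Fin 2 × Fin 2 → Fin 2)
    (f2 : Fin 2 → Fin 2 × Fin 2 → Fin 2) (f3 : Fin 2 → Fin 2 × Fin 2 → ℤ)
    (hf3 : ∀ s p, f3 s p = -1 ∨ f3 s p = 1) :
    ∑ x, T x * output3bit f1 f2 f3 x ≤ 16 := by
  let h : Fin 2 × Fin 2 → ℤ := fun a => (f1 a).val
  let e : Fin 2 × Fin 2 → ℤ := fun b => ((f2 1 b).val : ℤ) - ((f2 0 b).val : ℤ)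
  let v : Fin 2 × Fin 2 → ℤ := fun c => f3 1 c - f3 0 c
  have hh : ∀ a a', |h a - h a'| ≤ 1 := fun a a' => by
    rw [abs_le]; dsimp only [h]; omega
  have he : ∀ b b', |e b - e b'| ≤ 2 := fun b b' => by
    rw [abs_le]; dsimp only [e]; omega
  have hv : ∀ c c', |v c - v c'| ≤ 4 := fun c c' => by
    have h1 := hf3 0 c
    have h2 := hf3 1 c
    have h3 := hf3 0 c'
    have h4 := hf3 1 c'
    rw [abs_le]; dsimp only [v]; omega
  have key := trilinear_le_sixteen (hh (0, 0) (0, 1)) (hh (1, 0) (1, 1))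
    (he (0, 0) (0, 1)) (he (1, 0) (1, 1)) (hv (0, 1) (0, 0)) (hv (1, 0) (1, 1))
  refine le_of_eq_of_le ?_ key
  simp only [Fintype.sum_prod_type, output3bit_eq, Fin.sum_univ_two, T, row4, col16, M, h, e, v]
  simp
  ring

/-- every three-module one-bit classical sequential processor makes at
least 8 errors on the nonzero part of the target `T`. -/
theorem stmt4 (f1 : Fin 2 × Fin 2 → Fin 2) (f2 : Fin 2 → Fin 2 × Fin 2 → Fin 2)
    (f3 : Fin 2 → Fin 2 × Fin 2 → ℤ)
    (hf3 : ∀ s p, f3 s p = -1 ∨ f3 s p = 1) :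
    8 ≤ (Finset.univ.filter
      (fun x : Bits6 => T x ≠ 0 ∧ output3bit f1 f2 f3 x ≠ T x)).card := by
  have hT : ∀ x, T x = -1 ∨ T x = 0 ∨ T x = 1 := by decide
  have hsq : ∑ x, T x * T x = 32 := by rfl
  have hcard : ∑ x, (T x * T x - T x * output3bit f1 f2 f3 x) =
      2 * ((Finset.univ.filter
        (fun x : Bits6 => T x ≠ 0 ∧ output3bit f1 f2 f3 x ≠ T x)).card : ℤ) := by
    rw [Finset.card_filter, Nat.cast_sum, Finset.mul_sum]
    refine Finset.sum_congr rfl fun x _ => ?_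
    have hO : output3bit f1 f2 f3 x = -1 ∨ output3bit f1 f2 f3 x = 1 := hf3 _ _
    rcases hT x with ht | ht | ht <;> rcases hO with ho | ho <;> simp [ht, ho]
  rw [Finset.sum_sub_distrib, hsq] at hcard
  have := sum_T_mul_output3bit_le f1 f2 f3 hf3
  omega
end

section
/- The minimum over all three-module one-bit classical sequential processors of the number of errors of the output O with respect to the target function T, namely the cardinality of {x ∈ {0,1}^6 : T(x) ≠ 0 and O(x) ≠ T(x)}, equals exactly 8; in particular there exists such a processor achieving exactly 8 errors. -/
/-- The signed GHZ expression is at most `2 * (1 * 2 * 4)` on integers bounded by `1`, `2`, `4`. -/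
lemma ghz_expression_le {a₀ a₁ b₀ b₁ c₀ c₁ : ℤ}
    (ha₀ : |a₀| ≤ 1) (ha₁ : |a₁| ≤ 1) (hb₀ : |b₀| ≤ 2) (hb₁ : |b₁| ≤ 2)
    (hc₀ : |c₀| ≤ 4) (hc₁ : |c₁| ≤ 4) :
    -(a₀ * b₀ * c₀) + a₀ * b₁ * c₁ + a₁ * b₀ * c₁ + a₁ * b₁ * c₀ ≤ 16 := by
  rw [abs_le] at *
  obtain ⟨_, _⟩ := ha₀
  obtain ⟨_, _⟩ := ha₁
  obtain ⟨_, _⟩ := hb₀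
  obtain ⟨_, _⟩ := hb₁
  interval_cases a₀ <;> interval_cases a₁ <;> interval_cases b₀ <;> interval_cases b₁ <;> omega

/-- A function of a bit is affine in the value of that bit. -/
lemma apply_bit_eq_affine (g : Fin 2 → ℤ) (s : Fin 2) :
    g s = g 0 + (s.val : ℤ) * (g 1 - g 0) := by
  fin_cases s <;> simp

/-- Twice the number of errors of a `±1`-valued output is `32` minus its correlation with `T`. -/
lemma two_mul_card_errors (O : Bits6 → ℤ) (hO : ∀ x, O x = -1 ∨ O x = 1) :
    2 * ((Finset.univ.filter (fun x : Bits6 => T x ≠ 0 ∧ O x ≠ T x)).card : ℤ) =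
      32 - ∑ x, T x * O x := by
  have hT : ∀ x, T x = 0 ∨ T x = -1 ∨ T x = 1 := by decide
  have hcount : ∑ x, T x ^ 2 = 32 := by decide +kernel
  rw [Finset.card_filter, Nat.cast_sum, Finset.mul_sum, ← hcount, ← Finset.sum_sub_distrib]
  refine Finset.sum_congr rfl fun x _ => ?_
  rcases hT x with h | h | h <;> rcases hO x with h' | h' <;> simp [h, h']

/-- the minimum number of errors (on the nonzero part of the target `T`)
over all three-module one-bit classical sequential processors equals exactly 8; in
particular some processor achieves exactly 8 errors. -/
theorem stmt5 :
    IsLeast {n : ℕ | ∃ (f1 : Fin 2 × Fin 2 → Fin 2) (f2 : Fin 2 → Fin 2 × Fin 2 → Fin 2)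
        (f3 : Fin 2 → Fin 2 × Fin 2 → ℤ),
      (∀ s p, f3 s p = -1 ∨ f3 s p = 1) ∧
      n = (Finset.univ.filter
        (fun x : Bits6 => T x ≠ 0 ∧ output3bit f1 f2 f3 x ≠ T x)).card} 8 := by
  constructor
  · refine ⟨fun r => r.2, fun s q => s + q.2, fun s p => if s = p.2 then 1 else -1, ?_, ?_⟩
    · decide
    · decide +kernel
  · rintro n ⟨f1, f2, f3, hf3, rfl⟩
    have hcard := two_mul_card_errors (output3bit f1 f2 f3) fun _ => hf3 _ _
    have hcorr := sum_T_mul_output3bit_le f1 f2 f3 hf3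
    omega
end

section
/- The minimum over all three-module one-trit classical sequential processors of the number of errors of the output O with respect to the target function T3, namely the cardinality of {x ∈ {0,1}^6 : T3(x) ≠ 0 and O(x) ≠ T3(x)}, equals exactly 2; in particular there exists such a processor achieving exactly 2 errors. -/
/-- The 4×16 matrix defining the target function of the three-module single-qutrit
processor. -/
def M3 : Fin 4 → Fin 16 → ℤ :=
  ![![ 0,  0, -1,  1,  0,  0,  1, -1, -1,  1,  0,  0,  1, -1,  0,  0],
    ![ 0,  0,  1, -1,  0,  0, -1,  1,  1, -1,  0,  0, -1,  1,  0,  0],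
    ![-1,  1,  0,  0,  1, -1,  0,  0,  0,  0,  1, -1,  0,  0, -1,  1],
    ![ 1, -1,  0,  0, -1,  1,  0,  0,  0,  0, -1,  1,  0,  0,  1, -1]]

/-- The target function `T3 : {0,1}^6 → {-1,0,1}`. -/
def T3 : Bits6 → ℤ
  | (x1, x2, x3, x4, x5, x6) => M3 (row4 x1 x2) (col16 x3 x4 x5 x6)

/-- Output of a three-module one-trit classical sequential processor given by the
module strategies `g1`, `g2`, `g3`. -/
def output3trit (g1 : Fin 2 × Fin 2 → Fin 3) (g2 : Fin 3 → Fin 2 × Fin 2 → Fin 3)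
    (g3 : Fin 3 → Fin 2 × Fin 2 → ℤ) : Bits6 → ℤ
  | (x1, x2, x3, x4, x5, x6) => g3 (g2 (g1 (x1, x2)) (x3, x4)) (x5, x6)

/-- The six input bits assembled from the pairs fed to the three modules. -/
def assembleBits (r b c : Fin 2 × Fin 2) : Bits6 := (r.1, r.2, b.1, b.2, c.1, c.2)

/-- The inputs of the last module at which the target takes both signs on `{r, r'} × {b, b'}`. -/
def IsConflict (r r' b b' c : Fin 2 × Fin 2) : Prop :=
  ∃ x ∈ [r, r'], ∃ u ∈ [b, b'], ∃ y ∈ [r, r'], ∃ v ∈ [b, b'],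
    T3 (assembleBits x u c) = -1 ∧ T3 (assembleBits y v c) = 1

instance (r r' b b' c : Fin 2 × Fin 2) : Decidable (IsConflict r r' b b' c) := by
  unfold IsConflict
  infer_instance

theorem exists_two_isConflict : ∀ r r' b b' : Fin 2 × Fin 2, r ≠ r' → b ≠ b' →
    ∃ c c', c ≠ c' ∧ IsConflict r r' b b' c ∧ IsConflict r r' b b' c' := by
  decide +kernel

/-- An output that is constant on `{r, r'} × {b, b'} × {c}` errs there if `c` is a conflict. -/
theorem IsConflict.exists_error {r r' b b' c : Fin 2 × Fin 2} (h : IsConflict r r' b b' c)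
    {f : Bits6 → ℤ} {o : ℤ}
    (hf : ∀ x ∈ [r, r'], ∀ u ∈ [b, b'], f (assembleBits x u c) = o) :
    ∃ x u, T3 (assembleBits x u c) ≠ 0 ∧ f (assembleBits x u c) ≠ T3 (assembleBits x u c) := by
  obtain ⟨x, hx, u, hu, y, hy, v, hv, hneg, hpos⟩ := h
  by_cases ho : o = 1
  · exact ⟨x, u, by omega, by rw [hf x hx u hu]; omega⟩
  · exact ⟨y, v, by omega, by rw [hf y hy v hv]; omega⟩

theorem two_le_card_errors (g1 : Fin 2 × Fin 2 → Fin 3) (g2 : Fin 3 → Fin 2 × Fin 2 → Fin 3)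
    (g3 : Fin 3 → Fin 2 × Fin 2 → ℤ) :
    2 ≤ (Finset.univ.filter
      (fun x : Bits6 => T3 x ≠ 0 ∧ output3trit g1 g2 g3 x ≠ T3 x)).card := by
  obtain ⟨r, r', hr, hg1⟩ := Fintype.exists_ne_map_eq_of_card_lt g1 (by decide)
  obtain ⟨b, b', hb, hg2⟩ := Fintype.exists_ne_map_eq_of_card_lt (g2 (g1 r)) (by decide)
  have hconst : ∀ c, ∀ x ∈ [r, r'], ∀ u ∈ [b, b'],
      output3trit g1 g2 g3 (assembleBits x u c) = g3 (g2 (g1 r) b) c := by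
    simp [assembleBits, output3trit, ← hg1, ← hg2]
  obtain ⟨c, c', hc, h, h'⟩ := exists_two_isConflict r r' b b' hr hb
  obtain ⟨x, u, hxu⟩ := h.exists_error (hconst c)
  obtain ⟨y, v, hyv⟩ := h'.exists_error (hconst c')
  refine Finset.one_lt_card.2 ⟨assembleBits x u c, by simpa using hxu,
    assembleBits y v c', by simpa using hyv, fun heq => hc ?_⟩
  simp only [assembleBits, Prod.mk.injEq] at heq
  exact Prod.ext heq.2.2.2.2.1 heq.2.2.2.2.2

/-- the minimum number of errors (on the nonzero part of the target `T3`)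
over all three-module one-trit classical sequential processors equals exactly 2; in
particular some processor achieves exactly 2 errors. -/
theorem stmt8 :
    IsLeast {n : ℕ | ∃ (g1 : Fin 2 × Fin 2 → Fin 3) (g2 : Fin 3 → Fin 2 × Fin 2 → Fin 3)
        (g3 : Fin 3 → Fin 2 × Fin 2 → ℤ),
      (∀ s p, g3 s p = -1 ∨ g3 s p = 1) ∧
      n = (Finset.univ.filter
        (fun x : Bits6 => T3 x ≠ 0 ∧ output3trit g1 g2 g3 x ≠ T3 x)).card} 2 := by
  constructor
  · exact ⟨fun p => ![![0, 1], ![0, 2]] p.1 p.2,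
      fun s p => ![![![0, 1], ![2, 0]], ![![1, 0], ![1, 0]], ![![1, 0], ![0, 1]]] s p.1 p.2,
      fun s p => ![![![-1, 1], ![-1, 1]], ![![1, -1], ![1, -1]], ![![-1, 1], ![1, -1]]] s p.1 p.2,
      by decide, by decide +kernel⟩
  · rintro n ⟨g1, g2, g3, -, rfl⟩
    exact two_le_card_errors g1 g2 g3
end

section
/- For every four-module one-trit classical sequential processor with output O : {0,1}^8 → {-1,1}, the number of errors of O with respect to the target function T4, namely the cardinality of {x ∈ {0,1}^8 : T4(x) ≠ 0 and O(x) ≠ T4(x)}, is at least 16. -/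
/-- Domain of eight input bits. -/
abbrev Bits8 := Fin 2 × Fin 2 × Fin 2 × Fin 2 × Fin 2 × Fin 2 × Fin 2 × Fin 2

/-- The 16×16 matrix defining the target function of the four-module single-qutrit
processor. -/
def N : Fin 16 → Fin 16 → ℤ :=
  ![![ 0,  0, -1,  1,  0,  0,  1, -1, -1,  1,  0,  0,  1, -1,  0,  0],
    ![ 0,  0,  1, -1,  0,  0, -1,  1,  1, -1,  0,  0, -1,  1,  0,  0],
    ![-1,  1,  0,  0,  1, -1,  0,  0,  0,  0,  1, -1,  0,  0, -1,  1],
    ![ 1, -1,  0,  0, -1,  1,  0,  0,  0,  0, -1,  1,  0,  0,  1, -1],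
    ![ 1, -1,  0,  0, -1,  1,  0,  0,  0,  0, -1,  1,  0,  0,  1, -1],
    ![-1,  1,  0,  0,  1, -1,  0,  0,  0,  0,  1, -1,  0,  0, -1,  1],
    ![ 0,  0, -1,  1,  0,  0,  1, -1, -1,  1,  0,  0,  1, -1,  0,  0],
    ![ 0,  0,  1, -1,  0,  0, -1,  1,  1, -1,  0,  0, -1,  1,  0,  0],
    ![ 0,  0,  1, -1,  0,  0, -1,  1,  1, -1,  0,  0, -1,  1,  0,  0],
    ![ 0,  0, -1,  1,  0,  0,  1, -1, -1,  1,  0,  0,  1, -1,  0,  0],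
    ![ 1, -1,  0,  0, -1,  1,  0,  0,  0,  0, -1,  1,  0,  0,  1, -1],
    ![-1,  1,  0,  0,  1, -1,  0,  0,  0,  0,  1, -1,  0,  0, -1,  1],
    ![-1,  1,  0,  0,  1, -1,  0,  0,  0,  0,  1, -1,  0,  0, -1,  1],
    ![ 1, -1,  0,  0, -1,  1,  0,  0,  0,  0, -1,  1,  0,  0,  1, -1],
    ![ 0,  0,  1, -1,  0,  0, -1,  1,  1, -1,  0,  0, -1,  1,  0,  0],
    ![ 0,  0, -1,  1,  0,  0,  1, -1, -1,  1,  0,  0,  1, -1,  0,  0]]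

/-- Index `8*a + 4*b + 2*c + d` built from four bits. -/
def idx16 (a b c d : Fin 2) : Fin 16 :=
  ⟨8 * a.val + 4 * b.val + 2 * c.val + d.val, by omega⟩

/-- The target function `T4 : {0,1}^8 → {-1,0,1}`. -/
def T4 : Bits8 → ℤ
  | (x1, x2, x3, x4, x5, x6, x7, x8) => N (idx16 x1 x2 x3 x4) (idx16 x5 x6 x7 x8)

/-- Output of a four-module one-trit classical sequential processor given by the
module strategies `g1`, `g2`, `g3`, `g4`. -/
def output4trit (g1 : Fin 2 × Fin 2 → Fin 3) (g2 : Fin 3 → Fin 2 × Fin 2 → Fin 3)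
    (g3 : Fin 3 → Fin 2 × Fin 2 → Fin 3) (g4 : Fin 3 → Fin 2 × Fin 2 → ℤ) : Bits8 → ℤ
  | (x1, x2, x3, x4, x5, x6, x7, x8) =>
      g4 (g3 (g2 (g1 (x1, x2)) (x3, x4)) (x5, x6)) (x7, x8)

/-- Among three labels on the cyclic group of order four, two positions at distance one or two
carry the same label. -/
theorem exists_eq_add_one_or_add_two (σ : ZMod 4 → Fin 3) :
    (∃ k, σ (k + 1) = σ k) ∨ ∃ k, σ (k + 2) = σ k := by
  obtain ⟨x, y, hxy, h⟩ := Fintype.exists_ne_map_eq_of_card_lt σ (by simp [ZMod.card])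
  have key : ∀ x y : ZMod 4, x ≠ y → y = x + 1 ∨ y = x + 2 ∨ x = y + 1 := by decide
  rcases key x y hxy with rfl | rfl | rfl
  · exact .inl ⟨x, h.symm⟩
  · exact .inr ⟨x, h.symm⟩
  · exact .inl ⟨y, h⟩

theorem sum_zmod_four (f : ZMod 4 → ℕ) (j : ZMod 4) :
    ∑ k, f k = f j + f (j + 1) + f (j + 2) + f (j + 3) := by
  rw [← Equiv.sum_comp (Equiv.addLeft j) f]
  have univ_eq : (Finset.univ : Finset (ZMod 4)) = {0, 1, 2, 3} := by decide
  rw [univ_eq, Finset.sum_insert (by decide), Finset.sum_insert (by decide),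
    Finset.sum_pair (by decide)]
  simp [add_assoc]

theorem two_le_sum_adjacent {e : Fin 3 → ZMod 4 → ℕ} (he : ∀ m j, e m j + e m (j + 2) = 2)
    (τ : ZMod 4 → Fin 3) (k : ZMod 4) :
    2 ≤ ∑ c, e (τ c) (k + c) + ∑ c, e (τ c) (k + 1 + c) := by
  rw [← Finset.sum_add_distrib]
  rcases exists_eq_add_one_or_add_two τ with ⟨c, hc⟩ | ⟨c, hc⟩
  · rw [sum_zmod_four _ c, hc, show k + 1 + (c + 1) = k + c + 2 by ring]
    have := he (τ c) (k + c)
    omega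
  · rw [sum_zmod_four _ c, hc, show k + (c + 2) = k + c + 2 by ring]
    have := he (τ c) (k + c)
    omega

theorem two_le_sum_cost {V : Fin 3 → ZMod 4 → ℕ}
    (h_opp : ∀ s k, V s k + V s (k + 2) = 8) (h_adj : ∀ s k, 2 ≤ V s k + V s (k + 1))
    (σ : ZMod 4 → Fin 3) (a : ZMod 4) : 2 ≤ ∑ b, V (σ b) (a + b) := by
  rcases exists_eq_add_one_or_add_two σ with ⟨b, hb⟩ | ⟨b, hb⟩
  · rw [sum_zmod_four _ b, hb, ← add_assoc a b 1]
    have := h_adj (σ b) (a + b)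
    omega
  · rw [sum_zmod_four _ b, hb, ← add_assoc a b 2]
    have := h_opp (σ b) (a + b)
    omega

theorem twelve_le_sum_adjacent_cost {V : Fin 3 → ZMod 4 → ℕ}
    (h_opp : ∀ s k, V s k + V s (k + 2) = 8) (h_adj : ∀ s k, 2 ≤ V s k + V s (k + 1))
    (σ : ZMod 4 → Fin 3) (a : ZMod 4) :
    12 ≤ ∑ b, V (σ b) (a + b) + ∑ b, V (σ b) (a + 1 + b) := by
  rw [← Finset.sum_add_distrib]
  have adj : ∀ b, 2 ≤ V (σ b) (a + b) + V (σ b) (a + 1 + b) := fun b => by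
    simpa only [add_right_comm a 1 b] using h_adj (σ b) (a + b)
  rcases exists_eq_add_one_or_add_two σ with ⟨b, hb⟩ | ⟨b, hb⟩
  · have h2 := adj (b + 2)
    have h3 := adj (b + 3)
    have := h_opp (σ b) (a + b)
    rw [sum_zmod_four _ b, hb, show a + 1 + (b + 1) = a + b + 2 by ring]
    omega
  · have h0 := h_opp (σ b) (a + b)
    have h1 := h_opp (σ b) (a + 1 + b)
    rw [sum_zmod_four _ b, hb, ← add_assoc a b 2, ← add_assoc (a + 1) b 2]
    omega

theorem sixteen_le_sum_cost {V : Fin 3 → ZMod 4 → ℕ}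
    (h_opp : ∀ s k, V s k + V s (k + 2) = 8) (h_adj : ∀ s k, 2 ≤ V s k + V s (k + 1))
    (g₁ : ZMod 4 → Fin 3) (g₂ : Fin 3 → ZMod 4 → Fin 3) :
    16 ≤ ∑ a, ∑ b, V (g₂ (g₁ a) b) (a + b) := by
  rcases exists_eq_add_one_or_add_two g₁ with ⟨a, ha⟩ | ⟨a, ha⟩
  · rw [sum_zmod_four _ a, ha]
    have h01 := twelve_le_sum_adjacent_cost h_opp h_adj (g₂ (g₁ a)) a
    have h2 := two_le_sum_cost h_opp h_adj (g₂ (g₁ (a + 2))) (a + 2)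
    have h3 := two_le_sum_cost h_opp h_adj (g₂ (g₁ (a + 3))) (a + 3)
    omega
  · have h : ∑ b, V (g₂ (g₁ a) b) (a + b) + ∑ b, V (g₂ (g₁ a) b) (a + 2 + b) = 32 := by
      simp only [← Finset.sum_add_distrib, add_right_comm a 2, h_opp]
      simp [ZMod.card]
    rw [sum_zmod_four _ a, ha]
    omega

/-- If the last module makes `e m j` errors on label `m` and rotation `j`, with two errors in total
on each pair of opposite rotations, then the whole processor makes at least 16 errors. -/
theorem sixteen_le_sum_error {e : Fin 3 → ZMod 4 → ℕ} (he : ∀ m j, e m j + e m (j + 2) = 2)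
    (g₁ : ZMod 4 → Fin 3) (g₂ g₃ : Fin 3 → ZMod 4 → Fin 3) :
    16 ≤ ∑ a, ∑ b, ∑ c, e (g₃ (g₂ (g₁ a) b) c) (a + b + c) := by
  refine sixteen_le_sum_cost (V := fun s k => ∑ c, e (g₃ s c) (k + c)) (fun s k => ?_)
    (fun s k => two_le_sum_adjacent he (g₃ s) k) g₁ g₂
  simp only [← Finset.sum_add_distrib, add_right_comm k 2, he]
  simp [ZMod.card]

/-- The two-bit input of the first module that rotates the state by a given quarter turn. -/
def firstInput : ZMod 4 ≃ Fin 2 × Fin 2 where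
  toFun := ![(0, 0), (1, 1), (1, 0), (0, 1)]
  invFun p := ![![0, 3], ![2, 1]] p.1 p.2
  left_inv := by unfold Function.LeftInverse; decide
  right_inv := by unfold Function.RightInverse Function.LeftInverse; decide

/-- The two-bit input of a later module that rotates the state by a given quarter turn. -/
def laterInput : ZMod 4 ≃ Fin 2 × Fin 2 where
  toFun := ![(0, 0), (1, 0), (0, 1), (1, 1)]
  invFun p := ![![0, 2], ![1, 3]] p.1 p.2
  left_inv := by unfold Function.LeftInverse; decide
  right_inv := by unfold Function.RightInverse Function.LeftInverse; decide

/-- The target value as a function of the total rotation. -/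
def targetValue : ZMod 4 → ℤ := ![0, -1, 0, 1]

/-- The eight input bits producing four given quarter turns. -/
def inputBits : ZMod 4 × ZMod 4 × ZMod 4 × ZMod 4 ≃ Bits8 where
  toFun y := ((firstInput y.1).1, (firstInput y.1).2, (laterInput y.2.1).1, (laterInput y.2.1).2,
    (laterInput y.2.2.1).1, (laterInput y.2.2.1).2, (laterInput y.2.2.2).1, (laterInput y.2.2.2).2)
  invFun x := (firstInput.symm (x.1, x.2.1), laterInput.symm (x.2.2.1, x.2.2.2.1),
    laterInput.symm (x.2.2.2.2.1, x.2.2.2.2.2.1),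
    laterInput.symm (x.2.2.2.2.2.2.1, x.2.2.2.2.2.2.2))
  left_inv y := by simp
  right_inv x := by simp

theorem T4_inputBits (a b c d : ZMod 4) :
    T4 (inputBits (a, b, c, d)) = targetValue (a + b + c + d) := by
  revert a b c d
  decide

theorem error_add_error_opposite (g : ZMod 4 → ℤ) (hg : ∀ d, g d = -1 ∨ g d = 1) (j : ZMod 4) :
    (∑ d, if targetValue (j + d) ≠ 0 ∧ g d ≠ targetValue (j + d) then 1 else 0) +
      (∑ d, if targetValue (j + 2 + d) ≠ 0 ∧ g d ≠ targetValue (j + 2 + d) then 1 else 0) = 2 := by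
  have opp : ∀ k, targetValue (k + 2) = -targetValue k := by decide
  have val : ∀ k, targetValue k = 0 ∨ targetValue k = 1 ∨ targetValue k = -1 := by decide
  have term : ∀ d, ((if targetValue (j + d) ≠ 0 ∧ g d ≠ targetValue (j + d) then 1 else 0) +
      if targetValue (j + 2 + d) ≠ 0 ∧ g d ≠ targetValue (j + 2 + d) then 1 else 0) =
      (targetValue (j + d)).natAbs := fun d => by
    rw [add_right_comm j 2 d, opp]
    rcases val (j + d) with h | h | h <;> rcases hg d with h' | h' <;> simp [h, h']
  have total : ∀ j, ∑ d, (targetValue (j + d)).natAbs = 2 := by decide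
  rw [← Finset.sum_add_distrib, Finset.sum_congr rfl fun d _ => term d, total]

/-- every four-module one-trit classical sequential processor makes at
least 16 errors on the nonzero part of the target `T4`. -/
theorem stmt10 (g1 : Fin 2 × Fin 2 → Fin 3) (g2 : Fin 3 → Fin 2 × Fin 2 → Fin 3)
    (g3 : Fin 3 → Fin 2 × Fin 2 → Fin 3) (g4 : Fin 3 → Fin 2 × Fin 2 → ℤ)
    (hg4 : ∀ s p, g4 s p = -1 ∨ g4 s p = 1) :
    16 ≤ (Finset.univ.filter
      (fun x : Bits8 => T4 x ≠ 0 ∧ output4trit g1 g2 g3 g4 x ≠ T4 x)).card := by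
  rw [Finset.card_filter, ← Equiv.sum_comp inputBits]
  simp only [Fintype.sum_prod_type, T4_inputBits]
  exact sixteen_le_sum_error
    (fun m j => error_add_error_opposite (fun d => g4 m (laterInput d)) (fun d => hg4 m _) j)
    (fun a => g1 (firstInput a)) (fun s b => g2 s (laterInput b)) (fun s c => g3 s (laterInput c))
end

section
/- The minimum over all four-module one-trit classical sequential processors of the number of errors of the output O with respect to the target function T4, namely the cardinality of {x ∈ {0,1}^8 : T4(x) ≠ 0 and O(x) ≠ T4(x)}, equals exactly 16; in particular there exists such a processor achieving exactly 16 errors. -/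
/-- The phase in `ZMod 4` contributed by the first pair of bits. -/
def firstPhase (p : Fin 2 × Fin 2) : ZMod 4 :=
  (![![0, 3], ![2, 1]] : Fin 2 → Fin 2 → ZMod 4) p.1 p.2

/-- The phase in `ZMod 4` contributed by the second and by the third pair of bits. -/
def middlePhase (p : Fin 2 × Fin 2) : ZMod 4 :=
  (![![0, 2], ![1, 3]] : Fin 2 → Fin 2 → ZMod 4) p.1 p.2

/-- The value of the target as a function of the total phase and the last pair of bits. -/
def phaseTarget (z : ZMod 4) (d : Fin 2 × Fin 2) : ℤ :=
  (![![![0, 0], ![-1, 1]], ![![-1, 1], ![0, 0]], ![![0, 0], ![1, -1]], ![![1, -1], ![0, 0]]] :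
    Fin 4 → Fin 2 → Fin 2 → ℤ) z d.1 d.2

lemma firstPhase_injective : Function.Injective firstPhase := by
  unfold Function.Injective; decide

lemma middlePhase_injective : Function.Injective middlePhase := by
  unfold Function.Injective; decide

lemma T4_eq_phaseTarget (x1 x2 x3 x4 x5 x6 x7 x8 : Fin 2) :
    T4 (x1, x2, x3, x4, x5, x6, x7, x8) =
      phaseTarget (firstPhase (x1, x2) + middlePhase (x3, x4) + middlePhase (x5, x6))
        (x7, x8) := by
  revert x1 x2 x3 x4 x5 x6 x7 x8
  decide +kernel

/-- The number of errors of the sign pattern `w` against the target of phase `z`. -/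
def signErrors (w : Fin 2 × Fin 2 → ℤ) (z : ZMod 4) : ℕ :=
  ∑ d, if phaseTarget z d ≠ 0 ∧ w d ≠ phaseTarget z d then 1 else 0

lemma signErrors_add_antipode (w : Fin 2 × Fin 2 → ℤ) (hw : ∀ d, w d = -1 ∨ w d = 1)
    (z : ZMod 4) : signErrors w z + signErrors w (z + 2) = 2 := by
  have h00 := hw (0, 0)
  have h01 := hw (0, 1)
  have h10 := hw (1, 0)
  have h11 := hw (1, 1)
  simp only [signErrors, Fintype.sum_prod_type, Fin.sum_univ_two]
  generalize w (0, 0) = a at *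
  generalize w (0, 1) = b at *
  generalize w (1, 0) = c at *
  generalize w (1, 1) = d at *
  rcases h00 with rfl | rfl <;> rcases h01 with rfl | rfl <;> rcases h10 with rfl | rfl <;>
    rcases h11 with rfl | rfl <;> revert z <;> decide

/-- The errors accumulated from memory state `s` and phase `z` by a module `g`, when the modules
after it make `F s z` errors from state `s` and phase `z`. -/
def moduleErrors (F : Fin 3 → ZMod 4 → ℕ) (g : Fin 3 → Fin 2 × Fin 2 → Fin 3) (s : Fin 3)
    (z : ZMod 4) : ℕ :=
  ∑ b, F (g s b) (z + middlePhase b)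

/-- Two of four items distributed over three boxes share a box. -/
lemma le_sum_of_three_boxes (f : Fin 2 × Fin 2 → Fin 3) (G : Fin 3 → Fin 2 × Fin 2 → ℕ)
    (m p : ℕ) (hm : ∀ s b, m ≤ G s b) (hp : ∀ s b b', b ≠ b' → p ≤ G s b + G s b') :
    2 * m + p ≤ ∑ b, G (f b) b := by
  obtain ⟨b, b', hne, hf⟩ := Fintype.exists_ne_map_eq_of_card_lt f (by decide)
  have hpair : p ≤ ∑ x ∈ {b, b'}, G (f x) x := by
    rw [Finset.sum_pair hne, hf]
    exact hp _ _ _ hne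
  have hrest : 2 * m ≤ ∑ x ∈ ({b, b'} : Finset (Fin 2 × Fin 2))ᶜ, G (f x) x := by
    have h := Finset.card_nsmul_le_sum ({b, b'} : Finset (Fin 2 × Fin 2))ᶜ
      (fun x => G (f x) x) m fun x _ => hm _ _
    rw [Finset.card_compl, Finset.card_pair hne] at h
    simpa using h
  rw [← Finset.sum_add_sum_compl {b, b'}]
  omega

/-- Lower bounds on a function on the phase cycle and on its sums over neighbours give a lower
bound on its sums over any two distinct phases. -/
lemma le_add_of_ne {F : ZMod 4 → ℕ} {K p : ℕ} (hK : ∀ z, F z + F (z + 2) = K)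
    (hp : ∀ z, p ≤ F z + F (z + 1)) (hpK : p ≤ K) {z z' : ZMod 4} (hne : z ≠ z') :
    p ≤ F z + F z' := by
  have hcase : ∀ z z' : ZMod 4, z ≠ z' → z' = z + 1 ∨ z' = z + 2 ∨ z = z' + 1 := by decide
  rcases hcase z z' hne with rfl | rfl | rfl
  · exact hp z
  · exact hpK.trans_eq (hK z).symm
  · rw [add_comm]
    exact hp z'

section

variable {F : Fin 3 → ZMod 4 → ℕ} {K m p : ℕ} (g : Fin 3 → Fin 2 × Fin 2 → Fin 3)

lemma moduleErrors_add_antipode (hK : ∀ s z, F s z + F s (z + 2) = K) (s : Fin 3) (z : ZMod 4) :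
    moduleErrors F g s z + moduleErrors F g s (z + 2) = 4 * K := by
  simp only [moduleErrors, ← Finset.sum_add_distrib, add_right_comm z 2, hK]
  simp

lemma le_moduleErrors (hK : ∀ s z, F s z + F s (z + 2) = K) (hm : ∀ s z, m ≤ F s z)
    (hp : ∀ s z, p ≤ F s z + F s (z + 1)) (hpK : p ≤ K) (s : Fin 3) (z : ZMod 4) :
    2 * m + p ≤ moduleErrors F g s z :=
  le_sum_of_three_boxes (g s) (fun t b => F t (z + middlePhase b)) m p (fun _ _ => hm _ _)
    fun t _ _ hne => le_add_of_ne (hK t) (hp t) hpK fun h =>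
      hne (middlePhase_injective (add_left_cancel h))

lemma le_moduleErrors_add_succ (hK : ∀ s z, F s z + F s (z + 2) = K) (hm : ∀ s z, m ≤ F s z)
    (hp : ∀ s z, p ≤ F s z + F s (z + 1)) (hmK : 2 * m ≤ K) (s : Fin 3) (z : ZMod 4) :
    2 * p + (K + 2 * m) ≤ moduleErrors F g s z + moduleErrors F g s (z + 1) := by
  have key := le_sum_of_three_boxes (g s)
    (fun t b => F t (z + middlePhase b) + F t (z + middlePhase b + 1)) p (K + 2 * m)
    (fun _ _ => hp _ _) fun t b b' hne =>
      le_add_of_ne (F := fun y => F t y + F t (y + 1)) (K := 2 * K)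
        (fun y => by
          have h1 := hK t y
          have h2 := hK t (y + 1)
          rw [add_right_comm] at h2
          omega)
        (fun y => by
          have h1 := hK t y
          have h2 := hm t (y + 1)
          have h3 : y + 1 + 1 = y + 2 := by rw [add_assoc, one_add_one_eq_two]
          simp only [h3]
          omega)
        (by omega) fun h => hne (middlePhase_injective (add_left_cancel h))
  simpa only [moduleErrors, ← Finset.sum_add_distrib, add_right_comm z 1] using key

end

lemma card_errors_eq (g1 : Fin 2 × Fin 2 → Fin 3) (g2 g3 : Fin 3 → Fin 2 × Fin 2 → Fin 3)
    (g4 : Fin 3 → Fin 2 × Fin 2 → ℤ) :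
    (Finset.univ.filter
      (fun x : Bits8 => T4 x ≠ 0 ∧ output4trit g1 g2 g3 g4 x ≠ T4 x)).card =
    ∑ a, moduleErrors (moduleErrors (fun s => signErrors (g4 s)) g3) g2 (g1 a) (firstPhase a) := by
  rw [Finset.card_filter]
  simp only [moduleErrors, signErrors, Fintype.sum_prod_type, T4_eq_phaseTarget, output4trit]

lemma sixteen_le_card_errors (g1 : Fin 2 × Fin 2 → Fin 3)
    (g2 g3 : Fin 3 → Fin 2 × Fin 2 → Fin 3) (g4 : Fin 3 → Fin 2 × Fin 2 → ℤ)
    (h4 : ∀ s p, g4 s p = -1 ∨ g4 s p = 1) :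
    16 ≤ (Finset.univ.filter
      (fun x : Bits8 => T4 x ≠ 0 ∧ output4trit g1 g2 g3 g4 x ≠ T4 x)).card := by
  rw [card_errors_eq]
  have hK := fun s => signErrors_add_antipode (g4 s) (h4 s)
  have hK3 := moduleErrors_add_antipode g3 hK
  have hp3 := le_moduleErrors_add_succ (m := 0) (p := 0) g3 hK (by simp) (by simp) (by simp)
  have hK2 := moduleErrors_add_antipode g2 hK3
  have hm2 := le_moduleErrors (m := 0) g2 hK3 (by simp) hp3 (by norm_num)
  have hp2 := le_moduleErrors_add_succ (m := 0) g2 hK3 (by simp) hp3 (by norm_num)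
  exact le_sum_of_three_boxes g1 (fun t a => moduleErrors _ g2 t (firstPhase a)) 2 12
    (fun _ _ => hm2 _ _) fun t _ _ hne =>
      le_add_of_ne (hK2 t) (hp2 t) (by norm_num) (firstPhase_injective.ne hne)

/-- the minimum number of errors (on the nonzero part of the target `T4`)
over all four-module one-trit classical sequential processors equals exactly 16; in
particular some processor achieves exactly 16 errors. -/
theorem stmt11 :
    IsLeast {n : ℕ | ∃ (g1 : Fin 2 × Fin 2 → Fin 3) (g2 : Fin 3 → Fin 2 × Fin 2 → Fin 3)
        (g3 : Fin 3 → Fin 2 × Fin 2 → Fin 3) (g4 : Fin 3 → Fin 2 × Fin 2 → ℤ),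
      (∀ s p, g4 s p = -1 ∨ g4 s p = 1) ∧
      n = (Finset.univ.filter
        (fun x : Bits8 => T4 x ≠ 0 ∧ output4trit g1 g2 g3 g4 x ≠ T4 x)).card} 16 := by
  constructor
  · refine ⟨fun p => (![![1, 2], ![0, 1]] : Fin 2 → Fin 2 → Fin 3) p.1 p.2,
      fun s p => (![![![1, 0], ![0, 2]], ![![2, 1], ![2, 0]], ![![1, 2], ![0, 1]]] :
        Fin 3 → Fin 2 → Fin 2 → Fin 3) s p.1 p.2,
      fun s p => (![![![1, 0], ![1, 2]], ![![2, 1], ![2, 0]], ![![0, 2], ![0, 1]]] :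
        Fin 3 → Fin 2 → Fin 2 → Fin 3) s p.1 p.2,
      fun s p => (![![![-1, 1], ![1, -1]], ![![-1, 1], ![-1, 1]], ![![1, -1], ![1, -1]]] :
        Fin 3 → Fin 2 → Fin 2 → ℤ) s p.1 p.2, by decide, ?_⟩
    rw [card_errors_eq]
    decide +kernel
  · rintro n ⟨g1, g2, g3, g4, h4, rfl⟩
    exact sixteen_le_card_errors g1 g2 g3 g4 h4
end

section
/- The maximum over all four-module one-trit classical sequential processors of the correlation (1/256) · Σ_{x ∈ {0,1}^8} O(x) · T4(x) between the output O and the target function T4 equals 3/8 (i.e. 0.375). -/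
/-- The planar vector `(p, q)` lies in the octagon `|p| ≤ a`, `|q| ≤ a`, `|p ± q| ≤ b`. -/
def InOctagon (a b p q : ℤ) : Prop :=
  |p| ≤ a ∧ |q| ≤ a ∧ |p + q| ≤ b ∧ |p - q| ≤ b

/-- Four quarter turns of vectors chosen from a list of only three vectors of an octagon cannot
all be aligned, since two of the four vectors coincide. -/
theorem InOctagon.sum_quarter_turns {a b : ℤ} {p q : Fin 3 → ℤ}
    (h : ∀ t, InOctagon a b (p t) (q t)) (i j k l : Fin 3) :
    InOctagon (b + 2 * a) (2 * b + 2 * a)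
      (p i - p j + q k - q l) (q i - q j - p k + p l) := by
  have hi := h i
  have hj := h j
  have hk := h k
  have hl := h l
  have pigeonhole : i = j ∨ i = k ∨ i = l ∨ j = k ∨ j = l ∨ k = l := by omega
  simp only [InOctagon, abs_le] at *
  rcases pigeonhole with rfl | rfl | rfl | rfl | rfl | rfl <;> omega

/-- The correlation sum, with the processor evaluated module by module starting from the last. -/
theorem sum_output4trit_mul_T4 (g1 : Fin 2 × Fin 2 → Fin 3) (g2 : Fin 3 → Fin 2 × Fin 2 → Fin 3)
    (g3 : Fin 3 → Fin 2 × Fin 2 → Fin 3) (g4 : Fin 3 → Fin 2 × Fin 2 → ℤ)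
    (p q p' q' p'' q'' : Fin 3 → ℤ)
    (hp : ∀ t, p t = g4 t (1, 1) - g4 t (1, 0)) (hq : ∀ t, q t = g4 t (0, 1) - g4 t (0, 0))
    (hp' : ∀ s, p' s = p (g3 s (0, 0)) - p (g3 s (0, 1)) + q (g3 s (1, 0)) - q (g3 s (1, 1)))
    (hq' : ∀ s, q' s = q (g3 s (0, 0)) - q (g3 s (0, 1)) - p (g3 s (1, 0)) + p (g3 s (1, 1)))
    (hp'' : ∀ r, p'' r =
      p' (g2 r (0, 0)) - p' (g2 r (0, 1)) + q' (g2 r (1, 0)) - q' (g2 r (1, 1)))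
    (hq'' : ∀ r, q'' r =
      q' (g2 r (0, 0)) - q' (g2 r (0, 1)) - p' (g2 r (1, 0)) + p' (g2 r (1, 1))) :
    ∑ x : Bits8, output4trit g1 g2 g3 g4 x * T4 x =
      p'' (g1 (0, 0)) - p'' (g1 (1, 0)) + q'' (g1 (1, 1)) - q'' (g1 (0, 1)) := by
  simp only [Fintype.sum_prod_type, Fin.sum_univ_two, output4trit, T4, idx16, N,
    hp'', hq'', hp', hq', hp, hq]
  simp
  ring

/-- the maximum correlation `(1/256) · Σ_x O(x)·T4(x)` over all
four-module one-trit classical sequential processors equals `3/8 = 0.375`. -/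
theorem stmt12 :
    IsGreatest {c : ℚ | ∃ (g1 : Fin 2 × Fin 2 → Fin 3) (g2 : Fin 3 → Fin 2 × Fin 2 → Fin 3)
        (g3 : Fin 3 → Fin 2 × Fin 2 → Fin 3) (g4 : Fin 3 → Fin 2 × Fin 2 → ℤ),
      (∀ s p, g4 s p = -1 ∨ g4 s p = 1) ∧
      c = (1 / 256 : ℚ) * ∑ x : Bits8, ((output4trit g1 g2 g3 g4 x * T4 x : ℤ) : ℚ)}
      (3 / 8) := by
  constructor
  · refine ⟨fun x ↦ ![![2, 2], ![0, 1]] x.1 x.2,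
      fun s x ↦ ![![![1, 2], ![2, 0]], ![![0, 2], ![1, 2]], ![![2, 0], ![0, 1]]] s x.1 x.2,
      fun s x ↦ ![![![2, 1], ![0, 2]], ![![0, 2], ![1, 2]], ![![1, 2], ![2, 0]]] s x.1 x.2,
      fun s x ↦ ![![![1, -1], ![1, -1]], ![![1, -1], ![-1, 1]], ![![-1, 1], ![-1, 1]]] s x.1 x.2,
      by decide, ?_⟩
    rw [← Int.cast_sum, sum_output4trit_mul_T4 _ _ _ _ _ _ _ _ _ _ (fun _ ↦ rfl) (fun _ ↦ rfl)
      (fun _ ↦ rfl) (fun _ ↦ rfl) (fun _ ↦ rfl) (fun _ ↦ rfl)]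
    simp
    norm_num
  · rintro _ ⟨g1, g2, g3, g4, hg4, rfl⟩
    have first : ∀ t, InOctagon 2 4 (g4 t (1, 1) - g4 t (1, 0)) (g4 t (0, 1) - g4 t (0, 0)) := by
      intro t
      have h00 := hg4 t (0, 0)
      have h01 := hg4 t (0, 1)
      have h10 := hg4 t (1, 0)
      have h11 := hg4 t (1, 1)
      simp only [InOctagon, abs_le]
      omega
    have second := fun s ↦ InOctagon.sum_quarter_turns first
      (g3 s (0, 0)) (g3 s (0, 1)) (g3 s (1, 0)) (g3 s (1, 1))
    have third := fun r ↦ InOctagon.sum_quarter_turns second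
      (g2 r (0, 0)) (g2 r (0, 1)) (g2 r (1, 0)) (g2 r (1, 1))
    have bound := (abs_le.mp (InOctagon.sum_quarter_turns third
      (g1 (0, 0)) (g1 (1, 0)) (g1 (1, 1)) (g1 (0, 1))).1).2
    rw [← sum_output4trit_mul_T4 g1 g2 g3 g4 _ _ _ _ _ _ (fun _ ↦ rfl) (fun _ ↦ rfl)
      (fun _ ↦ rfl) (fun _ ↦ rfl) (fun _ ↦ rfl) (fun _ ↦ rfl)] at bound
    rw [← Int.cast_sum]
    have bound' : ((∑ x : Bits8, output4trit g1 g2 g3 g4 x * T4 x : ℤ) : ℚ) ≤ 96 := by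
      exact_mod_cast bound
    linarith
end
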